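/- arXiv:2203.02457 — 3 statements merged into one kernel-verified Lean document; each statement's English description precedes it below -/
import Mathlib

section
/- Fix an integer c ≥ 3. Then for every n ≥ 1, G_{{1,2c}}(n) = G_{{1,6}}(φ₁(n)). -/
/-- The minimum excludant of a set of naturals. -/
noncomputable def mex (S : Set ℕ) : ℕ := sInf {v | v ∉ S}

/-- Fueled auxiliary for the Grundy sequence of CUT with cut-set `C`. -/
noncomputable def cutGAux (C : Finset ℕ) : ℕ → ℕ → ℕ
  | 0, _ => 0
  | fuel + 1, n =>
      mex {v | ∃ d ∈ C, ∃ l : List ℕ, l.length = d + 1 ∧ (∀ x ∈ l, 0 < x) ∧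
            l.sum = n ∧ (l.map (cutGAux C fuel)).foldr (· ^^^ ·) 0 = v}

/-- The Grundy (nim-value) sequence of the game CUT with cut-set `C`. -/
noncomputable def cutG (C : Finset ℕ) (n : ℕ) : ℕ := cutGAux C n n

/-- The nim-value of an option (a tuple of pile sizes). -/
noncomputable def nimVal (C : Finset ℕ) (l : List ℕ) : ℕ :=
  (l.map (cutG C)).foldr (· ^^^ ·) 0

/-- The map `r ↦ r'` on `1 ≤ r ≤ 2c`. -/
def rPrime (c r : ℕ) : ℕ :=
  if r = 1 then 1
  else if r = 2 then 2
  else if r = 2*c - 1 then 5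
  else if r = 2*c then 6
  else if r % 2 = 1 then 3
  else 4

/-- The correspondence `φ_p`: writing `n = 2cq + r + p − 1` with `1 ≤ r ≤ 2c`,
`φ_p(n) = 6q + r' + p − 1`. -/
def phi (c p n : ℕ) : ℕ :=
  6 * ((n - p) / (2*c)) + rPrime c ((n - p) % (2*c) + 1) + p - 1

/-- The block index of a reduced nim-value, a norm subadditive under nim-sum. -/
def blockNorm (h : ℕ) : ℕ :=
  6 * (h / 8) + (if h % 8 = 0 then 0 else if h % 8 = 2 then 1 else if h % 8 = 1 then 2
    else if h % 8 = 5 then 2 else if h % 8 = 3 then 3 else if h % 8 = 7 then 3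
    else if h % 8 = 4 then 4 else 5)

/-- The residue modulo `8` of the reduced nim-value at offset `r` in a period of length `12 * c`. -/
def baseVal (c r : ℕ) : ℕ :=
  if r < 2 * c then 0 else if r < 4 * c then 2 else if r = 4 * c then 1
  else if r < 6 * c then 5 else if r < 8 * c then 3 else if r < 10 * c then 4 else 6

/-- The nim-value of a heap of size `m + 1`, with the parity of `m` removed. -/
def reducedVal (c m : ℕ) : ℕ := 8 * (m / (12 * c)) + baseVal c (m % (12 * c))

/-- The closed form of the nim-value of a heap of size `m + 1` in CUT for `{1, 2 * c}`. -/
def closedVal (c m : ℕ) : ℕ := reducedVal c m ^^^ (m % 2)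

theorem mex_eq {S : Set ℕ} {k : ℕ} (hk : k ∉ S) (h : ∀ v < k, v ∈ S) : mex S = k := by
  apply le_antisymm
  · exact Nat.sInf_le hk
  · by_contra! hlt
    exact (Nat.sInf_mem (s := {v | v ∉ S}) ⟨k, hk⟩) (h _ hlt)

theorem xor_div_eight (x y : ℕ) : (x ^^^ y) / 8 = x / 8 ^^^ y / 8 :=
  Nat.xor_div_two_pow (n := 3)

theorem xor_mod_eight (x y : ℕ) : (x ^^^ y) % 8 = x % 8 ^^^ y % 8 :=
  Nat.xor_mod_two_pow (n := 3)

theorem xor_le_add (x y : ℕ) : x ^^^ y ≤ x + y := by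
  induction x using Nat.strong_induction_on generalizing y with
  | _ x ih =>
    rcases Nat.eq_zero_or_pos x with rfl | hx
    · simp
    · have h1 := ih (x / 2) (by omega) (y / 2)
      have h2 : (x ^^^ y) / 2 = x / 2 ^^^ y / 2 := Nat.xor_div_two_pow (n := 1)
      have h3 : (x ^^^ y) % 2 = (x + y) % 2 := Nat.xor_mod_two_eq
      omega

theorem eight_mul_add_xor {a b : ℕ} (q p : ℕ) (ha : a < 8) (hb : b < 8) :
    (8 * q + a) ^^^ (8 * p + b) = 8 * (q ^^^ p) + (a ^^^ b) := by
  have h1 := xor_div_eight (8 * q + a) (8 * p + b)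
  have h2 := xor_mod_eight (8 * q + a) (8 * p + b)
  rw [show (8 * q + a) / 8 = q by omega, show (8 * p + b) / 8 = p by omega] at h1
  rw [show (8 * q + a) % 8 = a by omega, show (8 * p + b) % 8 = b by omega] at h2
  omega

theorem blockNorm_xor_le (x y : ℕ) : blockNorm (x ^^^ y) ≤ blockNorm x + blockNorm y := by
  have h1 := xor_le_add (x / 8) (y / 8)
  unfold blockNorm
  rw [xor_div_eight, xor_mod_eight]
  have hx : x % 8 < 8 := Nat.mod_lt _ (by norm_num)
  have hy : y % 8 < 8 := Nat.mod_lt _ (by norm_num)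
  generalize x % 8 = a at *
  generalize y % 8 = b at *
  interval_cases a <;> interval_cases b <;> simp <;> omega

theorem reducedVal_period {c r : ℕ} (Q : ℕ) (hr : r < 12 * c) :
    reducedVal c (12 * c * Q + r) = 8 * Q + baseVal c r := by
  have hc : 0 < 12 * c := by omega
  unfold reducedVal
  rw [Nat.mul_add_div hc, Nat.div_eq_of_lt hr, Nat.mul_add_mod, Nat.mod_eq_of_lt hr, add_zero]

theorem exists_period {c : ℕ} (hc : 0 < c) (m : ℕ) : ∃ Q r, r < 12 * c ∧ m = 12 * c * Q + r :=
  ⟨m / (12 * c), m % (12 * c), Nat.mod_lt _ (by omega), (Nat.div_add_mod _ _).symm⟩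

theorem baseVal_lt (c r : ℕ) : baseVal c r < 8 := by
  unfold baseVal; split_ifs <;> omega

theorem baseVal_cases (c r : ℕ) :
    (r < 2 * c ∧ baseVal c r = 0) ∨ (2 * c ≤ r ∧ r < 4 * c ∧ baseVal c r = 2) ∨
    (r = 4 * c ∧ baseVal c r = 1) ∨ (4 * c < r ∧ r < 6 * c ∧ baseVal c r = 5) ∨
    (6 * c ≤ r ∧ r < 8 * c ∧ baseVal c r = 3) ∨ (8 * c ≤ r ∧ r < 10 * c ∧ baseVal c r = 4) ∨
    (10 * c ≤ r ∧ baseVal c r = 6) := by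
  unfold baseVal
  split_ifs <;> omega

theorem blockNorm_reducedVal {c : ℕ} (hc : 0 < c) (m : ℕ) :
    blockNorm (reducedVal c m) * (2 * c) ≤ m ∧ m < blockNorm (reducedVal c m) * (2 * c) + 2 * c := by
  obtain ⟨Q, r, hr, rfl⟩ := exists_period hc m
  rw [reducedVal_period Q hr]
  have h8 := baseVal_lt c r
  have e : ∀ k, (6 * Q + k) * (2 * c) = 12 * c * Q + k * (2 * c) := fun k => by ring
  have e' : blockNorm (8 * Q + baseVal c r) = 6 * Q + blockNorm (baseVal c r) := by
    unfold blockNorm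
    rw [show (8 * Q + baseVal c r) / 8 = Q by omega,
      show (8 * Q + baseVal c r) % 8 = baseVal c r by omega,
      show baseVal c r / 8 = 0 by omega, show baseVal c r % 8 = baseVal c r by omega]
    omega
  rw [e', e]
  have h := baseVal_cases c r
  generalize 12 * c * Q = w
  generalize baseVal c r = k at *
  have hN : blockNorm k = (if k = 0 then 0 else if k = 2 then 1 else if k = 1 then 2
      else if k = 5 then 2 else if k = 3 then 3 else if k = 7 then 3 else if k = 4 then 4 else 5) := by
    rw [blockNorm, Nat.div_eq_of_lt h8, Nat.mod_eq_of_lt h8, mul_zero, zero_add]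
  rw [hN]
  rcases h with ⟨h, rfl⟩ | ⟨h, h', rfl⟩ | ⟨h, rfl⟩ | ⟨h, h', rfl⟩ | ⟨h, h', rfl⟩ | ⟨h, h', rfl⟩ |
    ⟨h, rfl⟩ <;> norm_num <;> omega

/-- A pair of heaps never attains the nim-value of their union. -/
theorem reducedVal_xor_ne {c : ℕ} (hc : 2 ≤ c) (a b : ℕ) :
    reducedVal c a ^^^ reducedVal c b ≠ reducedVal c (a + b + 1) ^^^ 1 := by
  obtain ⟨A, r, hr, rfl⟩ := exists_period (by omega : 0 < c) a
  obtain ⟨B, s, hs, rfl⟩ := exists_period (by omega : 0 < c) b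
  obtain ⟨D, t, ht, h⟩ := exists_period (by omega : 0 < c) (12 * c * A + r + (12 * c * B + s) + 1)
  rw [h, reducedVal_period A hr, reducedVal_period B hs, reducedVal_period D ht,
    eight_mul_add_xor _ _ (baseVal_lt _ _) (baseVal_lt _ _)]
  have h1 := eight_mul_add_xor D 0 (baseVal_lt c t) (by norm_num : 1 < 8)
  simp only [mul_zero, zero_add, Nat.xor_zero] at h1
  rw [h1]
  intro heq
  have hlt : baseVal c r ^^^ baseVal c s < 8 :=
    Nat.xor_lt_two_pow (n := 3) (baseVal_lt _ _) (baseVal_lt _ _)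
  have hlt' : baseVal c t ^^^ 1 < 8 := Nat.xor_lt_two_pow (n := 3) (baseVal_lt _ _) (by norm_num)
  have hD : A ^^^ B = D := by omega
  have hl : baseVal c r ^^^ baseVal c s = baseVal c t ^^^ 1 := by omega
  have hle := xor_le_add A B
  have hAB : A + B = D := by
    by_contra hne
    have : D + 1 ≤ A + B := by omega
    have := Nat.mul_le_mul_left (12 * c) this
    rw [mul_add, mul_add] at this
    omega
  have hrs : r + s + 1 = t := by
    subst hAB
    rw [mul_add] at h
    omega
  clear h hD hle hAB heq h1 hlt hlt'
  have h1 := baseVal_cases c r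
  have h2 := baseVal_cases c s
  have h3 := baseVal_cases c t
  generalize baseVal c r = x at *
  generalize baseVal c s = y at *
  generalize baseVal c t = z at *
  rcases h1 with ⟨h1, rfl⟩ | ⟨h1, h1', rfl⟩ | ⟨h1, rfl⟩ | ⟨h1, h1', rfl⟩ | ⟨h1, h1', rfl⟩ |
    ⟨h1, h1', rfl⟩ | ⟨h1, rfl⟩ <;>
  rcases h2 with ⟨h2, rfl⟩ | ⟨h2, h2', rfl⟩ | ⟨h2, rfl⟩ | ⟨h2, h2', rfl⟩ | ⟨h2, h2', rfl⟩ |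
    ⟨h2, h2', rfl⟩ | ⟨h2, rfl⟩ <;>
  rcases h3 with ⟨h3, rfl⟩ | ⟨h3, h3', rfl⟩ | ⟨h3, rfl⟩ | ⟨h3, h3', rfl⟩ | ⟨h3, h3', rfl⟩ |
    ⟨h3, h3', rfl⟩ | ⟨h3, rfl⟩ <;>
  first | exact absurd hl (by decide) | omega

theorem foldr_xor_closedVal (c : ℕ) (l : List ℕ) (hl : ∀ x ∈ l, 0 < x) :
    (l.map fun x => closedVal c (x - 1)).foldr (· ^^^ ·) 0 =
      (l.map fun x => reducedVal c (x - 1)).foldr (· ^^^ ·) 0 ^^^ ((l.sum + l.length) % 2) := by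
  induction l with
  | nil => simp
  | cons x l ih =>
    have hx := hl x (by simp)
    simp only [List.map_cons, List.foldr_cons, ih fun y hy => hl y (by simp [hy]), List.sum_cons,
      List.length_cons]
    have e : (x + l.sum + (l.length + 1)) % 2 = (x - 1) % 2 ^^^ (l.sum + l.length) % 2 := by
      have h1 : (x - 1) % 2 < 2 := Nat.mod_lt _ (by norm_num)
      have h2 : (l.sum + l.length) % 2 < 2 := Nat.mod_lt _ (by norm_num)
      have h3 : (x + l.sum + (l.length + 1)) % 2 = ((x - 1) % 2 + (l.sum + l.length) % 2) % 2 := by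
        omega
      rw [h3]
      generalize (x - 1) % 2 = a at *
      generalize (l.sum + l.length) % 2 = b at *
      interval_cases a <;> interval_cases b <;> rfl
    rw [e, closedVal]
    ac_rfl

theorem blockNorm_foldr_le {c : ℕ} (hc : 0 < c) (l : List ℕ) (hl : ∀ x ∈ l, 0 < x) :
    blockNorm ((l.map fun x => reducedVal c (x - 1)).foldr (· ^^^ ·) 0) * (2 * c) + l.length
      ≤ l.sum := by
  induction l with
  | nil => simp [blockNorm]
  | cons x l ih =>
    have hx := hl x (by simp)
    have h1 := ih fun y hy => hl y (by simp [hy])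
    simp only [List.map_cons, List.foldr_cons, List.sum_cons, List.length_cons]
    have h2 := Nat.mul_le_mul_right (2 * c) (blockNorm_xor_le (reducedVal c (x - 1))
      ((l.map fun x => reducedVal c (x - 1)).foldr (· ^^^ ·) 0))
    have h3 := (blockNorm_reducedVal hc (x - 1)).1
    rw [add_mul] at h2
    omega

/-- The options of a heap of size `m + 1`, valued by the closed form. -/
def closedOptions (c m : ℕ) : Set ℕ :=
  {v | ∃ d ∈ ({1, 2 * c} : Finset ℕ), ∃ l : List ℕ, l.length = d + 1 ∧ (∀ x ∈ l, 0 < x) ∧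
    l.sum = m + 1 ∧ (l.map fun x => closedVal c (x - 1)).foldr (· ^^^ ·) 0 = v}

theorem closedVal_notMem_closedOptions {c : ℕ} (hc : 2 ≤ c) (m : ℕ) :
    closedVal c m ∉ closedOptions c m := by
  rintro ⟨d, hd, l, hlen, hpos, hsum, hv⟩
  simp only [Finset.mem_insert, Finset.mem_singleton] at hd
  rw [foldr_xor_closedVal c l hpos, hlen, hsum, closedVal] at hv
  rcases hd with rfl | rfl
  · obtain ⟨x, y, rfl⟩ := List.length_eq_two.1 hlen
    have hx := hpos x (by simp)
    have hy := hpos y (by simp)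
    simp only [List.sum_cons, List.sum_nil, add_zero] at hsum
    simp only [List.map_cons, List.map_nil, List.foldr_cons, List.foldr_nil, Nat.xor_zero] at hv
    have hm : m = (x - 1) + (y - 1) + 1 := by omega
    have hne := reducedVal_xor_ne hc (x - 1) (y - 1)
    rw [← hm] at hne
    apply hne
    have e : m % 2 ^^^ (m + 1 + (1 + 1)) % 2 = 1 := by
      rcases Nat.mod_two_eq_zero_or_one m with h | h
      · rw [h, show (m + 1 + (1 + 1)) % 2 = 1 by omega]; rfl
      · rw [h, show (m + 1 + (1 + 1)) % 2 = 0 by omega]; rfl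
    have hv' := congrArg (· ^^^ (m + 1 + (1 + 1)) % 2) hv
    simpa only [Nat.xor_assoc, Nat.xor_self, Nat.xor_zero, e] using hv'
  · rw [show (m + 1 + (2 * c + 1)) % 2 = m % 2 by omega] at hv
    have hv := Nat.xor_left_injective hv
    have h1 := blockNorm_foldr_le (by omega : 0 < c) l hpos
    have h2 := (blockNorm_reducedVal (by omega : 0 < c) m).2
    rw [hv] at h1
    omega

theorem xor_mem_closedOptions_of_pair {c m x y : ℕ} (h : x + y + 1 = m) :
    (reducedVal c x ^^^ reducedVal c y) ^^^ 1 ^^^ (m % 2) ∈ closedOptions c m := by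
  refine ⟨1, by simp, [x + 1, y + 1], by simp, by simp, by simp; omega, ?_⟩
  rw [foldr_xor_closedVal _ _ (by simp)]
  simp only [List.map_cons, List.map_nil, List.foldr_cons, List.foldr_nil, Nat.xor_zero,
    Nat.add_sub_cancel, Nat.xor_assoc, List.sum_cons, List.sum_nil, List.length_cons,
    List.length_nil]
  congr 2
  rcases Nat.mod_two_eq_zero_or_one m with h' | h'
  · rw [h', show (x + 1 + (y + 1 + 0) + (0 + 1 + 1)) % 2 = 1 by omega]; rfl
  · rw [h', show (x + 1 + (y + 1 + 0) + (0 + 1 + 1)) % 2 = 0 by omega]; rfl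

theorem foldr_xor_replicate_zero (k : ℕ) :
    (List.replicate k 0).foldr (· ^^^ ·) 0 = 0 := by
  induction k with
  | zero => rfl
  | succ k ih => simp [List.replicate_succ, ih]

theorem reducedVal_of_lt {c m : ℕ} (h : m < 2 * c) : reducedVal c m = 0 := by
  have := reducedVal_period (c := c) (r := m) 0 (by omega)
  simpa [baseVal, h] using this

theorem xor_mem_closedOptions_of_le {c m x y : ℕ} (hc : 2 ≤ c) (h : x + y + 2 * c ≤ m) :
    (reducedVal c x ^^^ reducedVal c y) ^^^ (m % 2) ∈ closedOptions c m := by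
  obtain ⟨z, r, hr, hz⟩ : ∃ z r, r < 2 ∧ x + y + 2 * z + r + 2 * c = m :=
    ⟨(m - (x + y + 2 * c)) / 2, (m - (x + y + 2 * c)) % 2, by omega, by omega⟩
  have hpos : ∀ w ∈ [x + 1, y + 1, z + 1, z + 1, r + 1] ++ List.replicate (2 * c - 4) 1, 0 < w := by
    intro w hw
    simp at hw
    omega
  have hlen : ([x + 1, y + 1, z + 1, z + 1, r + 1] ++ List.replicate (2 * c - 4) 1).length
      = 2 * c + 1 := by
    simp; omega
  have hsum : ([x + 1, y + 1, z + 1, z + 1, r + 1] ++ List.replicate (2 * c - 4) 1).sum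
      = m + 1 := by
    simp only [List.sum_append, List.sum_cons, List.sum_nil, List.sum_replicate, smul_eq_mul]
    omega
  refine ⟨2 * c, by simp, _, hlen, hpos, hsum, ?_⟩
  rw [foldr_xor_closedVal _ _ hpos, hlen, hsum, show (m + 1 + (2 * c + 1)) % 2 = m % 2 by omega]
  congr 1
  simp only [List.map_append, List.map_replicate, List.foldr_append, List.map_cons, List.map_nil,
    Nat.sub_self, reducedVal_of_lt (show 0 < 2 * c by omega), foldr_xor_replicate_zero,
    List.foldr_cons, List.foldr_nil, Nat.add_sub_cancel,
    reducedVal_of_lt (show r < 2 * c by omega), Nat.xor_zero, Nat.xor_self]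

/-- The least total offset at which the residue `l` is a nim-sum of two base values. -/
def leastOffset (c l : ℕ) : ℕ :=
  if l = 0 then 0 else if l = 1 then 4 * c else if l = 2 then 2 * c else if l = 3 then 6 * c
  else if l = 4 then 8 * c else if l = 5 then 4 * c + 1 else if l = 6 then 10 * c else 6 * c + 1

theorem leastOffset_le {c : ℕ} (hc : 1 ≤ c) (l : ℕ) : leastOffset c l ≤ 10 * c := by
  unfold leastOffset
  split_ifs <;> omega

theorem mem_closedOptions_of_leastOffset_le {c m k l : ℕ} (hc : 2 ≤ c) (hl : l < 8)
    (h : 12 * c * k + leastOffset c l + 2 * c ≤ m) :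
    (8 * k + l) ^^^ (m % 2) ∈ closedOptions c m := by
  by_cases h7 : l = 7
  · subst h7
    have hm : 12 * c * k + 2 * c + (4 * c + 1) + 2 * c ≤ m := by
      simp only [leastOffset] at h
      norm_num at h
      omega
    have key := xor_mem_closedOptions_of_le hc hm
    have hy := reducedVal_period (c := c) (r := 4 * c + 1) 0 (by omega)
    rw [mul_zero, zero_add] at hy
    have b2 : baseVal c (2 * c) = 2 := by unfold baseVal; split_ifs <;> omega
    have b5 : baseVal c (4 * c + 1) = 5 := by unfold baseVal; split_ifs <;> omega
    rw [reducedVal_period k (by omega), hy, b2, b5, eight_mul_add_xor k 0 (by norm_num) (by norm_num),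
      Nat.xor_zero] at key
    exact key
  · have key := xor_mem_closedOptions_of_le (x := 12 * c * k + leastOffset c l) (y := 0) hc h
    have hlt := leastOffset_le (by omega : 1 ≤ c) l
    have hb : baseVal c (leastOffset c l) = l := by
      have hcases := baseVal_cases c (leastOffset c l)
      generalize baseVal c (leastOffset c l) = b at hcases ⊢
      unfold leastOffset at hcases
      split_ifs at hcases <;> omega
    rwa [reducedVal_period k (by omega), reducedVal_of_lt (show 0 < 2 * c by omega), hb,
      Nat.xor_zero] at key

theorem leastOffset_le_or_exists_pair {c r v : ℕ} (hc : 2 ≤ c) (hr : r < 12 * c)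
    (hv : v < baseVal c r ^^^ (r % 2)) :
    leastOffset c (v ^^^ (r % 2)) + 2 * c ≤ r ∨
      ∃ a b, a + b + 1 = r ∧ baseVal c a ^^^ baseVal c b ^^^ 1 = v ^^^ (r % 2) := by
  have hzero : ∀ x, x < 2 * c → baseVal c x = 0 := fun x hx => by
    simp [baseVal, hx]
  have htwo : ∀ x, 2 * c ≤ x → x < 4 * c → baseVal c x = 2 := fun x hx hx' => by
    unfold baseVal; split_ifs <;> omega
  have hfive : ∀ x, 4 * c < x → x < 6 * c → baseVal c x = 5 := fun x hx hx' => by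
    unfold baseVal; split_ifs <;> omega
  have hL := baseVal_cases c r
  generalize baseVal c r = L at *
  obtain ⟨p, hp, hpr⟩ : ∃ p, r % 2 = p ∧ p < 2 := ⟨_, rfl, Nat.mod_lt _ (by norm_num)⟩
  rw [hp] at hv ⊢
  rcases hL with ⟨h, rfl⟩ | ⟨h, h', rfl⟩ | ⟨h, rfl⟩ | ⟨h, h', rfl⟩ | ⟨h, h', rfl⟩ | ⟨h, h', rfl⟩ |
    ⟨h, rfl⟩ <;> interval_cases p <;> simp only [Nat.reduceXor] at hv
  all_goals interval_cases v <;>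
  first
  | omega
  | (left; norm_num [leastOffset]; omega)
  | (right; refine ⟨r - 1, 0, by omega, ?_⟩
     rw [hzero (r - 1) (by omega), hzero 0 (by omega)]; rfl)
  | (right; refine ⟨2 * c - 1, r - 2 * c, by omega, ?_⟩
     rw [hzero (2 * c - 1) (by omega), hzero (r - 2 * c) (by omega)]; rfl)
  | (right; refine ⟨r - 1, 0, by omega, ?_⟩
     rw [htwo (r - 1) (by omega) (by omega), hzero 0 (by omega)]; rfl)
  | (right; refine ⟨2 * c, r - 2 * c - 1, by omega, ?_⟩
     rw [htwo (2 * c) (by omega) (by omega), htwo (r - 2 * c - 1) (by omega) (by omega)]; rfl)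
  | (right; refine ⟨4 * c - 1, r - 4 * c, by omega, ?_⟩
     rw [htwo (4 * c - 1) (by omega) (by omega), hzero (r - 4 * c) (by omega)]; rfl)
  | (right; refine ⟨r - 1, 0, by omega, ?_⟩
     rw [hfive (r - 1) (by omega) (by omega), hzero 0 (by omega)]; rfl)

theorem mem_closedOptions_of_lt {c m : ℕ} (hc : 2 ≤ c) {v : ℕ} (hv : v < closedVal c m) :
    v ∈ closedOptions c m := by
  obtain ⟨Q, r, hr, rfl⟩ := exists_period (by omega : 0 < c) m
  have hpar : (12 * c * Q + r) % 2 = r % 2 := by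
    rw [show 12 * c * Q + r = 2 * (6 * c * Q) + r by ring]
    omega
  have hp : r % 2 < 8 := by omega
  have split : ∀ k a, a < 8 → (8 * k + a) ^^^ (r % 2) = 8 * k + (a ^^^ r % 2) := fun k a ha => by
    have := eight_mul_add_xor k 0 ha hp
    rwa [mul_zero, zero_add, Nat.xor_zero] at this
  have hxor : ∀ a, a < 8 → a ^^^ r % 2 < 8 := fun a ha => Nat.xor_lt_two_pow (n := 3) ha hp
  rw [closedVal, reducedVal_period Q hr, hpar, split _ _ (baseVal_lt c r)] at hv
  have hlt := hxor _ (baseVal_lt c r)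
  obtain ⟨k, l, hl, rfl⟩ : ∃ k l, l < 8 ∧ v = 8 * k + l := ⟨v / 8, v % 8, by omega, by omega⟩
  have hvl : 8 * k + l = (8 * k + (l ^^^ r % 2)) ^^^ ((12 * c * Q + r) % 2) := by
    rw [hpar, split _ _ (hxor l hl), Nat.xor_assoc, Nat.xor_self, Nat.xor_zero]
  rw [hvl]
  rcases Nat.lt_or_ge k Q with hk | hk
  · apply mem_closedOptions_of_leastOffset_le hc (hxor l hl)
    have h1 := Nat.mul_le_mul_left (12 * c) hk
    rw [Nat.succ_eq_add_one, mul_add] at h1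
    have h2 := leastOffset_le (by omega : 1 ≤ c) (l ^^^ r % 2)
    omega
  · obtain rfl : k = Q := by omega
    rcases leastOffset_le_or_exists_pair hc hr (v := l) (by omega) with h | ⟨a, b, hab, h⟩
    · exact mem_closedOptions_of_leastOffset_le hc (hxor l hl) (by omega)
    · have key := xor_mem_closedOptions_of_pair (c := c) (x := 12 * c * k + a) (y := b)
        (m := 12 * c * k + r) (by omega)
      have hb := reducedVal_period (c := c) (r := b) 0 (by omega)
      have h1 := eight_mul_add_xor k 0 (baseVal_lt c a) (baseVal_lt c b)
      have h2 := eight_mul_add_xor (a := baseVal c a ^^^ baseVal c b) (b := 1) k 0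
        (Nat.xor_lt_two_pow (n := 3) (baseVal_lt c a) (baseVal_lt c b)) (by norm_num)
      simp only [mul_zero, zero_add, Nat.xor_zero] at hb h1 h2
      rwa [reducedVal_period k (by omega), hb, h1, h2, h] at key

theorem cutGAux_eq_closedVal {c : ℕ} (hc : 2 ≤ c) (fuel m : ℕ) (hm : m < fuel) :
    cutGAux {1, 2 * c} fuel (m + 1) = closedVal c m := by
  induction fuel generalizing m with
  | zero => omega
  | succ fuel ih =>
    have hset : {v | ∃ d ∈ ({1, 2 * c} : Finset ℕ), ∃ l : List ℕ, l.length = d + 1 ∧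
        (∀ x ∈ l, 0 < x) ∧ l.sum = m + 1 ∧
        (l.map (cutGAux {1, 2 * c} fuel)).foldr (· ^^^ ·) 0 = v} = closedOptions c m := by
      ext v
      refine exists_congr fun d => and_congr_right fun hd => exists_congr fun l =>
        and_congr_right fun hlen => and_congr_right fun hpos => and_congr_right fun hsum => ?_
      have hmap : l.map (cutGAux {1, 2 * c} fuel) = l.map fun x => closedVal c (x - 1) := by
        refine List.map_congr_left fun x hx => ?_
        have hx0 := hpos x hx
        have hd1 : 1 ≤ d := by
          simp only [Finset.mem_insert, Finset.mem_singleton] at hd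
          omega
        have h1 : (l.erase x).length ≤ (l.erase x).sum :=
          List.length_le_sum_of_one_le _ fun y hy => hpos y (List.mem_of_mem_erase hy)
        have h2 := List.length_erase_of_mem hx
        have h3 := List.sum_erase hx
        have := ih (x - 1) (by omega)
        rwa [Nat.sub_add_cancel hx0] at this
      rw [hmap]
    rw [cutGAux, hset]
    exact mex_eq (closedVal_notMem_closedOptions hc m) fun v hv => mem_closedOptions_of_lt hc hv

theorem cutG_eq_closedVal {c : ℕ} (hc : 2 ≤ c) (m : ℕ) :
    cutG {1, 2 * c} (m + 1) = closedVal c m :=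
  cutGAux_eq_closedVal hc _ _ (Nat.lt_succ_self m)

theorem reducedVal_block {c s : ℕ} (q : ℕ) (hs : s < 2 * c) :
    reducedVal c (2 * c * q + s) = 8 * (q / 6) + (if q % 6 = 0 then 0 else if q % 6 = 1 then 2
      else if q % 6 = 2 then (if s = 0 then 1 else 5) else if q % 6 = 3 then 3
      else if q % 6 = 4 then 4 else 6) := by
  have hq := Nat.div_add_mod q 6
  have ht : q % 6 < 6 := Nat.mod_lt _ (by norm_num)
  have e : 2 * c * q + s = 12 * c * (q / 6) + (2 * c * (q % 6) + s) := by
    conv_lhs => rw [← hq]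
    ring
  rw [e]
  generalize q % 6 = t at *
  have hlt : 2 * c * t + s < 12 * c := by
    interval_cases t <;> omega
  rw [reducedVal_period _ hlt]
  unfold baseVal
  interval_cases t <;> simp <;> split_ifs <;> omega

/-- For `c ≥ 3`, the nim-sequence of CUT for `{1, 2c}` is obtained from that of
`{1, 6}` via the correspondence `φ₁`. -/
theorem cutG_phi_correspondence (c : ℕ) (hc : 3 ≤ c) (n : ℕ) (hn : 1 ≤ n) :
    cutG {1, 2*c} n = cutG {1, 6} (phi c 1 n) := by
  obtain ⟨m, rfl⟩ : ∃ m, n = m + 1 := ⟨n - 1, by omega⟩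
  obtain ⟨q, s, hs, rfl⟩ : ∃ q s, s < 2 * c ∧ m = 2 * c * q + s :=
    ⟨m / (2 * c), m % (2 * c), Nat.mod_lt _ (by omega), (Nat.div_add_mod _ _).symm⟩
  obtain ⟨s', hs', h0, hpar, hphi⟩ : ∃ s', s' < 2 * 3 ∧ (s = 0 ↔ s' = 0) ∧ s % 2 = s' % 2 ∧
      phi c 1 (2 * c * q + s + 1) = 2 * 3 * q + s' + 1 := by
    refine ⟨rPrime c (s + 1) - 1, ?_⟩
    have hpos : 0 < 2 * c := by omega
    have hphi : phi c 1 (2 * c * q + s + 1) = 6 * q + rPrime c (s + 1) := by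
      rw [phi, Nat.add_sub_cancel, Nat.add_sub_cancel, Nat.mul_add_div hpos, Nat.div_eq_of_lt hs,
        Nat.mul_add_mod, Nat.mod_eq_of_lt hs, add_zero]
    rw [hphi]
    unfold rPrime
    split_ifs <;> refine ⟨by omega, ⟨fun _ => by omega, fun h => by first | omega | exact h.elim⟩,
      by omega, by omega⟩
  rw [hphi, cutG_eq_closedVal (by omega), show (6 : ℕ) = 2 * 3 from rfl,
    cutG_eq_closedVal (by norm_num)]
  unfold closedVal
  rw [reducedVal_block q hs, reducedVal_block q hs', show (2 * c * q + s) % 2 = s % 2 by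
      rw [mul_assoc]; omega, show (2 * 3 * q + s') % 2 = s' % 2 by omega, hpar]
  simp only [h0]
end

section
/- Fix an integer c ≥ 3. For every n with 1 ≤ n ≤ 12c, N(n, 2c+1, {1, 2c}) = N(φ₁(n), 7, {1, 6}). -/
/-- The nim-set `N(n, p, C)`. -/
def nimSet (n p : ℕ) (C : Finset ℕ) : Set ℕ :=
  {v | ∃ l : List ℕ, l.length = p ∧ (∀ x ∈ l, 0 < x) ∧ l.sum = n ∧ nimVal C l = v}

/-- The value `f` such that pile size `k + 1` has Grundy value `f ^^^ (k % 2)` in the game with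
cut-set `{1, 2c}`, for `k < 12c`. -/
def bandVal (c k : ℕ) : ℕ :=
  if k < 2*c then 0
  else if k < 4*c then 2
  else if k = 4*c then 1
  else if k < 6*c then 5
  else if k < 8*c then 3
  else if k < 10*c then 4
  else 6

lemma bandVal_spec (c k : ℕ) :
    (bandVal c k = 0 ∧ k < 2*c) ∨ (bandVal c k = 2 ∧ 2*c ≤ k ∧ k < 4*c) ∨
    (bandVal c k = 1 ∧ 4*c = k) ∨ (bandVal c k = 5 ∧ 4*c < k ∧ k < 6*c) ∨
    (bandVal c k = 3 ∧ 6*c ≤ k ∧ k < 8*c) ∨ (bandVal c k = 4 ∧ 8*c ≤ k ∧ k < 10*c) ∨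
    (bandVal c k = 6 ∧ 10*c ≤ k) := by
  unfold bandVal
  split_ifs <;> omega

/-- Closed form of the Grundy value of a pile of size `n` with `1 ≤ n ≤ 12c`. -/
def grundyForm (c n : ℕ) : ℕ := bandVal c (n - 1) ^^^ ((n - 1) % 2)

/-- The values `⊕ bandVal c kᵢ` that occur for `∑ kᵢ = m < 10c`. -/
def BandSum (c m v : ℕ) : Prop :=
  v = 0 ∨ (2*c ≤ m ∧ v = 2) ∨ (4*c ≤ m ∧ v = 1) ∨ (4*c < m ∧ v = 5) ∨
    (6*c ≤ m ∧ v = 3) ∨ (6*c < m ∧ v = 7) ∨ (8*c ≤ m ∧ v = 4)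

/-- The nim-sum of `g` over a list. -/
def xorMap (g : ℕ → ℕ) (l : List ℕ) : ℕ := (l.map g).foldr (· ^^^ ·) 0

@[simp] lemma xorMap_nil (g : ℕ → ℕ) : xorMap g [] = 0 := rfl

@[simp] lemma xorMap_cons (g : ℕ → ℕ) (a : ℕ) (l : List ℕ) :
    xorMap g (a :: l) = g a ^^^ xorMap g l := rfl

lemma xorMap_congr {g g' : ℕ → ℕ} {l : List ℕ} (h : ∀ x ∈ l, g x = g' x) :
    xorMap g l = xorMap g' l := by
  unfold xorMap
  rw [List.map_congr_left h]

lemma mex_eq_s16 {S : Set ℕ} {a : ℕ} (ha : a ∉ S) (h : ∀ b < a, b ∈ S) : mex S = a := by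
  refine le_antisymm (Nat.sInf_le ha) (le_csInf ⟨a, ha⟩ fun b hb => ?_)
  by_contra! hlt
  exact hb (h b hlt)

lemma mod_two_xor (a b : ℕ) : (a % 2) ^^^ (b % 2) = (a + b) % 2 := by
  rcases Nat.mod_two_eq_zero_or_one a with ha | ha <;>
    rcases Nat.mod_two_eq_zero_or_one b with hb | hb <;> simp [Nat.add_mod, ha, hb]

lemma BandSum.add {c m v : ℕ} (k : ℕ) (hm : k + m < 10*c) (h : BandSum c m v) :
    BandSum c (k + m) (bandVal c k ^^^ v) := by
  unfold BandSum at h ⊢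
  unfold bandVal
  rcases h with h | ⟨h0, h⟩ | ⟨h0, h⟩ | ⟨h0, h⟩ | ⟨h0, h⟩ | ⟨h0, h⟩ | ⟨h0, h⟩ <;> subst h <;>
    split_ifs <;> simp <;> omega

lemma xor_xor_xor_comm (a b x y : ℕ) : (a ^^^ b) ^^^ (x ^^^ y) = (a ^^^ x) ^^^ (b ^^^ y) := by
  ac_rfl

lemma xorMap_grundyForm (c : ℕ) (l : List ℕ) :
    ∀ m, (∀ x ∈ l, 0 < x) → l.sum = m + l.length → m < 10*c →
      ∃ v, BandSum c m v ∧ xorMap (grundyForm c) l = v ^^^ (m % 2) := by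
  induction l with
  | nil =>
    intro m _ hs _
    have : m = 0 := by simpa using hs.symm
    subst this
    exact ⟨0, Or.inl rfl, rfl⟩
  | cons a l ih =>
    intro m hpos hs hm
    have ha : 0 < a := hpos a (by simp)
    have hlen : l.length ≤ l.sum :=
      List.length_le_sum_of_one_le l fun x hx => hpos x (by simp [hx])
    simp only [List.sum_cons, List.length_cons] at hs
    obtain ⟨v, hv, he⟩ := ih (l.sum - l.length) (fun x hx => hpos x (by simp [hx]))
      (by omega) (by omega)
    have hm' : m = (a - 1) + (l.sum - l.length) := by omega
    refine ⟨bandVal c (a - 1) ^^^ v, hm' ▸ hv.add (a - 1) (by omega), ?_⟩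
    rw [xorMap_cons, he, grundyForm, xor_xor_xor_comm, mod_two_xor, ← hm']

/-- A small remainder can be spread over `t` piles whose Grundy values only record parity. -/
lemma exists_padding (c : ℕ) (hc : 3 ≤ c) (t : ℕ) :
    ∀ R, R ≤ t * (2*c - 1) → ∃ l : List ℕ, l.length = t ∧ (∀ x ∈ l, 0 < x) ∧
      l.sum = R + t ∧ xorMap (grundyForm c) l = R % 2 := by
  induction t with
  | zero =>
    intro R hR
    have : R = 0 := by simpa using hR
    subst this
    exact ⟨[], by simp⟩
  | succ t ih =>
    intro R hR
    have hR' : R ≤ t * (2*c - 1) + (2*c - 1) := by rwa [Nat.succ_mul] at hR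
    obtain ⟨l, hl, hpos, hs, hx⟩ := ih (R - min R (2*c - 1)) (by omega)
    refine ⟨(min R (2*c - 1) + 1) :: l, by simp [hl], ?_, ?_, ?_⟩
    · intro x hxl
      rcases List.mem_cons.1 hxl with rfl | h
      · omega
      · exact hpos x h
    · simp only [List.sum_cons, hs]
      omega
    · have h0 : bandVal c (min R (2*c - 1)) = 0 := by
        unfold bandVal
        rw [if_pos (by omega)]
      rw [xorMap_cons, hx, grundyForm, Nat.add_sub_cancel, h0, Nat.zero_xor, mod_two_xor]
      congr 1
      omega

lemma BandSum.exists_pair {c m v : ℕ} (hc : 3 ≤ c) (hm : m < 10*c) (h : BandSum c m v) :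
    ∃ a b, a + b ≤ m ∧ m < a + b + 8*c ∧ bandVal c a ^^^ bandVal c b = v := by
  have hz : bandVal c 0 = 0 := by unfold bandVal; rw [if_pos (by omega)]
  have h2 : bandVal c (2*c) = 2 := by unfold bandVal; split_ifs <;> omega
  have h1 : bandVal c (4*c) = 1 := by unfold bandVal; split_ifs <;> omega
  have h5 : bandVal c (4*c + 1) = 5 := by unfold bandVal; split_ifs <;> omega
  have h3 : bandVal c (6*c) = 3 := by unfold bandVal; split_ifs <;> omega
  have h4 : bandVal c (8*c) = 4 := by unfold bandVal; split_ifs <;> omega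
  rcases h with h | ⟨h0, h⟩ | ⟨h0, h⟩ | ⟨h0, h⟩ | ⟨h0, h⟩ | ⟨h0, h⟩ | ⟨h0, h⟩ <;> subst h
  · by_cases h : m < 4*c
    · exact ⟨0, 0, by omega, by omega, by simp⟩
    · exact ⟨2*c, 2*c, by omega, by omega, by simp⟩
  · exact ⟨2*c, 0, by omega, by omega, by simp [h2, hz]⟩
  · exact ⟨4*c, 0, by omega, by omega, by simp [h1, hz]⟩
  · exact ⟨4*c + 1, 0, by omega, by omega, by simp [h5, hz]⟩
  · exact ⟨6*c, 0, by omega, by omega, by simp [h3, hz]⟩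
  · exact ⟨4*c + 1, 2*c, by omega, by omega, by simp [h5, h2]⟩
  · exact ⟨8*c, 0, by omega, by omega, by simp [h4, hz]⟩

lemma BandSum.exists_list {c m v : ℕ} (hc : 3 ≤ c) (hm : m < 10*c) (h : BandSum c m v) :
    ∃ l : List ℕ, l.length = 2*c + 1 ∧ (∀ x ∈ l, 0 < x) ∧ l.sum = m + (2*c + 1) ∧
      xorMap (grundyForm c) l = v ^^^ (m % 2) := by
  obtain ⟨a, b, hab, hab', rfl⟩ := h.exists_pair hc hm
  have hcap : 8*c ≤ (2*c - 1) * (2*c - 1) + 1 := by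
    obtain ⟨d, rfl⟩ := Nat.exists_eq_add_of_le hc
    have : 2*(3 + d) - 1 = 2*d + 5 := by omega
    rw [this]
    nlinarith
  obtain ⟨l, hl, hpos, hs, hx⟩ := exists_padding c hc (2*c - 1) (m - (a + b)) (by omega)
  refine ⟨(a + 1) :: (b + 1) :: l, by simp [hl]; omega, ?_, ?_, ?_⟩
  · intro x hxl
    simp only [List.mem_cons] at hxl
    rcases hxl with rfl | rfl | h
    · omega
    · omega
    · exact hpos x h
  · simp only [List.sum_cons, hs]
    omega
  · rw [xorMap_cons, xorMap_cons, hx, grundyForm, grundyForm, Nat.add_sub_cancel,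
      Nat.add_sub_cancel, ← Nat.xor_assoc, xor_xor_xor_comm, Nat.xor_assoc, mod_two_xor,
      mod_two_xor]
    congr 2
    omega

/-- The nim-values of the options of `n` consisting of `2c + 1` piles, in closed form. -/
lemma xorMap_grundyForm_iff {c n : ℕ} (hc : 3 ≤ c) (hn : n ≤ 12*c) (v : ℕ) :
    (∃ l : List ℕ, l.length = 2*c + 1 ∧ (∀ x ∈ l, 0 < x) ∧ l.sum = n ∧
      xorMap (grundyForm c) l = v) ↔
    2*c + 1 ≤ n ∧ BandSum c (n - (2*c + 1)) (v ^^^ ((n - 1) % 2)) := by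
  have hpar : 2*c + 1 ≤ n → (n - (2*c + 1)) % 2 = (n - 1) % 2 := by omega
  constructor
  · rintro ⟨l, hl, hpos, hs, rfl⟩
    have hlen : l.length ≤ l.sum := List.length_le_sum_of_one_le l hpos
    obtain ⟨w, hw, he⟩ := xorMap_grundyForm c l (n - (2*c + 1)) hpos (by omega) (by omega)
    refine ⟨by omega, ?_⟩
    rw [he, ← hpar (by omega), Nat.xor_assoc, Nat.xor_self, Nat.xor_zero]
    exact hw
  · rintro ⟨hle, h⟩
    obtain ⟨l, hl, hpos, hs, hx⟩ := h.exists_list hc (by omega)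
    refine ⟨l, hl, hpos, by omega, ?_⟩
    rw [hx, hpar hle, Nat.xor_assoc, Nat.xor_self, Nat.xor_zero]

lemma bandVal_pair_ne (c a b : ℕ) (hab : a + b + 1 < 12*c) :
    bandVal c a ^^^ bandVal c b ≠ bandVal c (a + b + 1) ^^^ 1 := by
  intro h
  have hK : bandVal c (a + b + 1) = bandVal c a ^^^ bandVal c b ^^^ 1 := by
    rw [h, Nat.xor_assoc, Nat.xor_self, Nat.xor_zero]
  clear h
  have hs := bandVal_spec c (a + b + 1)
  rcases bandVal_spec c a with ⟨ha, ha'⟩ | ⟨ha, ha'⟩ | ⟨ha, ha'⟩ | ⟨ha, ha'⟩ | ⟨ha, ha'⟩ |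
      ⟨ha, ha'⟩ | ⟨ha, ha'⟩ <;>
    rcases bandVal_spec c b with ⟨hb, hb'⟩ | ⟨hb, hb'⟩ | ⟨hb, hb'⟩ | ⟨hb, hb'⟩ | ⟨hb, hb'⟩ |
      ⟨hb, hb'⟩ | ⟨hb, hb'⟩ <;>
    rw [ha, hb] at hK <;> simp only [Nat.reduceXor] at hK <;> omega

/-- The closed form is not attained by splitting into two piles. -/
lemma pair_ne {c : ℕ} (a b : ℕ) (hab : a + b + 1 < 12*c) :
    (bandVal c a ^^^ (a % 2)) ^^^ (bandVal c b ^^^ (b % 2)) ≠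
      bandVal c (a + b + 1) ^^^ ((a + b + 1) % 2) := by
  rw [xor_xor_xor_comm, mod_two_xor]
  intro he
  refine bandVal_pair_ne c a b hab (Nat.xor_left_injective (x := (a + b) % 2) ?_)
  have : (a + b + 1) % 2 = 1 ^^^ ((a + b) % 2) := by
    rw [add_comm, ← mod_two_xor]
  rwa [this, ← Nat.xor_assoc] at he

/-- Every smaller value is attained, by splitting into `2c + 1` or into two piles. -/
lemma exists_pair_of_lt {c K : ℕ} (hc : 3 ≤ c) (hK : K < 12*c) (v : ℕ)
    (hv : v < bandVal c K ^^^ (K % 2)) :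
    (2*c ≤ K ∧ BandSum c (K - 2*c) (v ^^^ (K % 2))) ∨
      ∃ a b, a + b + 1 = K ∧ (bandVal c a ^^^ (a % 2)) ^^^ (bandVal c b ^^^ (b % 2)) = v := by
  have pair : ∀ a b w, a + b + 1 = K → bandVal c a ^^^ bandVal c b = w →
      w ^^^ ((K + 1) % 2) = v →
      ∃ a b, a + b + 1 = K ∧ (bandVal c a ^^^ (a % 2)) ^^^ (bandVal c b ^^^ (b % 2)) = v := by
    intro a b w hab hw h
    refine ⟨a, b, hab, ?_⟩
    rw [xor_xor_xor_comm, mod_two_xor, hw, ← h]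
    congr 1
    omega
  have zero : ∀ a, a < 2*c → bandVal c a = 0 := fun a ha => by
    have := bandVal_spec c a
    omega
  have two : ∀ a, 2*c ≤ a → a < 4*c → bandVal c a = 2 := fun a ha ha' => by
    have := bandVal_spec c a
    omega
  have five : ∀ a, 4*c < a → a < 6*c → bandVal c a = 5 := fun a ha ha' => by
    have := bandVal_spec c a
    omega
  have big : 2*c ≤ K → BandSum c (K - 2*c) (v ^^^ (K % 2)) →
      (2*c ≤ K ∧ BandSum c (K - 2*c) (v ^^^ (K % 2))) ∨
      ∃ a b, a + b + 1 = K ∧ (bandVal c a ^^^ (a % 2)) ^^^ (bandVal c b ^^^ (b % 2)) = v :=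
    fun h h' => Or.inl ⟨h, h'⟩
  have z0 : bandVal c 0 = 0 := zero 0 (by omega)
  have hpar : (K % 2 = 0 ∧ (K + 1) % 2 = 1) ∨ (K % 2 = 1 ∧ (K + 1) % 2 = 0) := by omega
  rcases bandVal_spec c K with ⟨hb, h1⟩ | ⟨hb, h1⟩ | ⟨hb, h1⟩ | ⟨hb, h1⟩ | ⟨hb, h1⟩ | ⟨hb, h1⟩ |
    ⟨hb, h1⟩
  · refine Or.inr (pair (K - 1) 0 0 ?_ ?_ ?_)
    · rcases hpar with ⟨hp, hp'⟩ | ⟨hp, hp'⟩ <;> rw [hb, hp] at hv <;>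
        simp only [Nat.reduceXor] at hv <;> omega
    · rw [zero _ (by omega), z0, Nat.xor_self]
    · rcases hpar with ⟨hp, hp'⟩ | ⟨hp, hp'⟩ <;> rw [hb, hp] at hv <;>
        simp only [Nat.reduceXor] at hv <;> simp [hp'] <;> omega
  · have low : bandVal c (2*c - 1) ^^^ bandVal c (K - 2*c) = 0 := by
      rw [zero _ (by omega), zero _ (by omega), Nat.xor_self]
    rcases hpar with ⟨hp, hp'⟩ | ⟨hp, hp'⟩ <;> rw [hb, hp] at hv <;>
      simp only [Nat.reduceXor] at hv <;> simp only [hp, hp'] at pair big ⊢ <;> interval_cases v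
    · exact big (by omega) (by simp [BandSum])
    · exact Or.inr (pair _ _ _ (by omega) low (by simp))
    · exact Or.inr (pair _ _ _ (by omega) low (by simp))
    · exact big (by omega) (by simp [BandSum])
    · exact Or.inr (pair (K - 1) 0 2 (by omega)
        (by rw [two _ (by omega) (by omega), z0, Nat.xor_zero]) (by simp))
  · obtain rfl : v = 0 := by
      have : K % 2 = 0 := by omega
      rw [hb, this] at hv
      simp only [Nat.reduceXor] at hv
      omega
    refine big (by omega) (Or.inl ?_)
    rw [Nat.zero_xor]
    omega
  · have low : bandVal c (2*c) ^^^ bandVal c (K - 1 - 2*c) = 0 := by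
      rw [two _ (by omega) (by omega), two _ (by omega) (by omega), Nat.xor_self]
    have mid : bandVal c (4*c - 1) ^^^ bandVal c (K - 4*c) = 2 := by
      rw [two _ (by omega) (by omega), zero _ (by omega), Nat.xor_zero]
    rcases hpar with ⟨hp, hp'⟩ | ⟨hp, hp'⟩ <;> rw [hb, hp] at hv <;>
      simp only [Nat.reduceXor] at hv <;> simp only [hp, hp'] at pair big ⊢ <;> interval_cases v
    · exact big (by omega) (by simp [BandSum])
    · exact Or.inr (pair _ _ _ (by omega) low (by simp))
    · exact big (by omega) (by simp [BandSum]; omega)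
    · exact Or.inr (pair _ _ _ (by omega) mid (by simp))
    · exact Or.inr (pair (K - 1) 0 5 (by omega)
        (by rw [five _ (by omega) (by omega), z0, Nat.xor_zero]) (by simp))
    · exact Or.inr (pair _ _ _ (by omega) low (by simp))
    · exact big (by omega) (by simp [BandSum])
    · exact Or.inr (pair _ _ _ (by omega) mid (by simp))
    · exact big (by omega) (by simp [BandSum]; omega)
  all_goals
    rcases hpar with ⟨hp, hp'⟩ | ⟨hp, hp'⟩ <;> rw [hb, hp] at hv <;>
      simp only [Nat.reduceXor] at hv <;> simp only [hp] at big ⊢ <;> interval_cases v <;>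
      exact big (by omega) (by simp [BandSum] <;> omega)

lemma cutGAux_eq {c : ℕ} (hc : 3 ≤ c) (fuel : ℕ) :
    ∀ n, 1 ≤ n → n ≤ fuel → n ≤ 12*c → cutGAux {1, 2*c} fuel n = grundyForm c n := by
  induction fuel with
  | zero => intro n h1 h2; omega
  | succ fuel ih =>
    intro n h1 h2 h3
    have hlist : ∀ l : List ℕ, 2 ≤ l.length → (∀ x ∈ l, 0 < x) → l.sum = n →
        (l.map (cutGAux {1, 2*c} fuel)).foldr (· ^^^ ·) 0 = xorMap (grundyForm c) l := by
      intro l hl hpos hs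
      refine xorMap_congr fun x hx => ?_
      have hlt : x < n := by
        obtain ⟨s, t, rfl⟩ := List.append_of_mem hx
        have h4 := List.length_le_sum_of_one_le s fun y hy => hpos y (by simp [hy])
        have h5 := List.length_le_sum_of_one_le t fun y hy => hpos y (by simp [hy])
        simp only [List.length_append, List.length_cons, List.sum_append, List.sum_cons] at *
        omega
      exact ih x (hpos x hx) (by omega) (by omega)
    rw [cutGAux]
    apply mex_eq_s16
    · rintro ⟨d, hd, l, hl, hpos, hs, hx⟩
      simp only [Finset.mem_insert, Finset.mem_singleton] at hd
      rw [hlist l (by omega) hpos hs] at hx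
      rcases hd with rfl | rfl
      · obtain ⟨a, b, rfl⟩ := List.length_eq_two.1 hl
        have ha : 0 < a := hpos a (by simp)
        have hb : 0 < b := hpos b (by simp)
        simp only [List.sum_cons, List.sum_nil] at hs
        refine pair_ne (c := c) (a - 1) (b - 1) (by omega) ?_
        have : a - 1 + (b - 1) + 1 = n - 1 := by omega
        simpa [this, grundyForm] using hx
      · obtain ⟨hle, h⟩ := (xorMap_grundyForm_iff hc h3 _).1 ⟨l, hl, hpos, hs, hx⟩
        rw [grundyForm, Nat.xor_assoc, Nat.xor_self, Nat.xor_zero] at h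
        unfold BandSum at h
        have := bandVal_spec c (n - 1)
        omega
    · intro v hv
      rcases exists_pair_of_lt hc (by omega) v hv with ⟨hle, h⟩ | ⟨a, b, hab, hx⟩
      · have hsub : n - 1 - 2*c = n - (2*c + 1) := by omega
        rw [hsub] at h
        obtain ⟨l, hl, hpos, hs, hx⟩ := (xorMap_grundyForm_iff hc h3 v).2 ⟨by omega, h⟩
        exact ⟨2*c, by simp, l, hl, hpos, hs, by rw [hlist l (by omega) hpos hs, hx]⟩
      · have hpos : ∀ x ∈ [a + 1, b + 1], 0 < x := by simp
        have hs : [a + 1, b + 1].sum = n := by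
          simp only [List.sum_cons, List.sum_nil]
          omega
        refine ⟨1, by simp, [a + 1, b + 1], rfl, hpos, hs, ?_⟩
        rw [hlist _ (by simp) hpos hs]
        simpa [grundyForm] using hx

lemma mem_nimSet_iff {c n : ℕ} (hc : 3 ≤ c) (hn : n ≤ 12*c) (v : ℕ) :
    v ∈ nimSet n (2*c + 1) {1, 2*c} ↔
      2*c + 1 ≤ n ∧ BandSum c (n - (2*c + 1)) (v ^^^ ((n - 1) % 2)) := by
  rw [← xorMap_grundyForm_iff hc hn]
  refine exists_congr fun l => and_congr_right fun _ => and_congr_right fun hpos =>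
    and_congr_right fun hs => ?_
  have : nimVal {1, 2*c} l = xorMap (grundyForm c) l := by
    refine xorMap_congr fun x hx => ?_
    have := List.single_le_sum (l := l) (by simp) x hx
    exact cutGAux_eq hc x x (hpos x hx) le_rfl (by omega)
  rw [this]

lemma rPrime_spec {c : ℕ} (hc : 3 ≤ c) (r : ℕ) :
    1 ≤ rPrime c r ∧ rPrime c r ≤ 6 ∧ (rPrime c r = 1 ↔ r = 1) ∧ rPrime c r % 2 = r % 2 := by
  unfold rPrime
  split_ifs <;> omega

/-- For `c ≥ 3` and `1 ≤ n ≤ 12c`, `N(n, 2c+1, {1, 2c}) = N(φ₁(n), 7, {1, 6})`. -/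
theorem nimSet_phi_big_cut (c : ℕ) (hc : 3 ≤ c) (n : ℕ) (hn1 : 1 ≤ n)
    (hn2 : n ≤ 12*c) :
    nimSet n (2*c + 1) {1, 2*c} = nimSet (phi c 1 n) 7 {1, 6} := by
  ext v
  have hlt : (n - 1) % (2*c) < 2*c := Nat.mod_lt _ (by omega)
  have hdiv := Nat.div_add_mod (n - 1) (2*c)
  have hq : (n - 1) / (2*c) < 6 := by
    rw [Nat.div_lt_iff_lt_mul (by omega)]
    omega
  obtain ⟨hr1, hr6, hr, hpar⟩ := rPrime_spec hc ((n - 1) % (2*c) + 1)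
  have hphi : phi c 1 n =
      6 * ((n - 1) / (2*c)) + rPrime c ((n - 1) % (2*c) + 1) := rfl
  generalize (n - 1) / (2*c) = q at *
  generalize (n - 1) % (2*c) = s at *
  generalize rPrime c (s + 1) = t at *
  have hphi12 : phi c 1 n ≤ 12 * 3 := by omega
  rw [mem_nimSet_iff hc hn2]
  refine Iff.trans ?_ (mem_nimSet_iff le_rfl hphi12 v).symm
  rw [hphi]
  have hpar' : (6*q + t - 1) % 2 = (n - 1) % 2 := by
    rw [← hdiv, mul_assoc]
    omega
  rw [hpar']
  generalize v ^^^ ((n - 1) % 2) = w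
  have e0 : 2*c + 1 ≤ n ↔ 2*3 + 1 ≤ 6*q + t := by interval_cases q <;> omega
  have e1 : 2*c ≤ n - (2*c + 1) ↔ 2*3 ≤ 6*q + t - (2*3 + 1) := by interval_cases q <;> omega
  have e2 : 4*c ≤ n - (2*c + 1) ↔ 4*3 ≤ 6*q + t - (2*3 + 1) := by interval_cases q <;> omega
  have e3 : 4*c < n - (2*c + 1) ↔ 4*3 < 6*q + t - (2*3 + 1) := by interval_cases q <;> omega
  have e4 : 6*c ≤ n - (2*c + 1) ↔ 6*3 ≤ 6*q + t - (2*3 + 1) := by interval_cases q <;> omega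
  have e5 : 6*c < n - (2*c + 1) ↔ 6*3 < 6*q + t - (2*3 + 1) := by interval_cases q <;> omega
  have e6 : 8*c ≤ n - (2*c + 1) ↔ 8*3 ≤ 6*q + t - (2*3 + 1) := by interval_cases q <;> omega
  unfold BandSum
  rw [e0, e1, e2, e3, e4, e5, e6]
end

section
/- Let S be a nonempty finite set of integers each of which is at least 2, let c = min S, let C₁ = {1} ∪ {2s : s ∈ S}, and let C₂ = {1, 2c}. Then for every n ≥ 1, G_{C₁}(n) = G_{C₂}(n). -/
/-- The first period of the nim-sequence of CUT with cut-set `{1, m}`, shifted to start at `0`. -/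
def cutBase (m x : ℕ) : ℕ :=
  if x < m then x % 2 else if x < 2 * m then 2 + x % 2 else if x = 2 * m then 1
  else if x < 3 * m then 5 - x % 2 else if x < 4 * m then 3 - x % 2
  else if x < 5 * m then 4 + x % 2 else 6 + x % 2

/-- The nim-sequence of CUT with cut-set `{1, m}`, shifted to start at `0`: it is
arithmetic-periodic with period `6 * m` and saltus `8`. -/
def cutSeq (m x : ℕ) : ℕ := 8 * (x / (6 * m)) + cutBase m (x % (6 * m))

lemma cutBase_lt (m x : ℕ) : cutBase m x < 8 := by
  unfold cutBase; split_ifs <;> omega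

lemma cutSeq_add {m x : ℕ} (t : ℕ) (hx : x < 6 * m) :
    cutSeq m (6 * m * t + x) = 8 * t + cutBase m x := by
  unfold cutSeq
  rw [Nat.mul_add_div (by omega), Nat.mul_add_mod, Nat.div_eq_of_lt hx, Nat.mod_eq_of_lt hx,
    add_zero]

lemma cutSeq_of_lt {m x : ℕ} (hx : x < 6 * m) : cutSeq m x = cutBase m x := by
  simpa using cutSeq_add 0 hx

lemma eight_mul_add_xor_s19 (a b : ℕ) {i j : ℕ} (hi : i < 8) (hj : j < 8) :
    (8 * a + i) ^^^ (8 * b + j) = 8 * (a ^^^ b) + (i ^^^ j) := by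
  have hx : i ^^^ j < 8 := Nat.xor_lt_two_pow (n := 3) hi hj
  have h1 : ((8 * a + i) ^^^ (8 * b + j)) / 8 = a ^^^ b := by
    rw [show (8 : ℕ) = 2 ^ 3 from rfl, Nat.xor_div_two_pow]
    congr 1 <;> omega
  have h2 : ((8 * a + i) ^^^ (8 * b + j)) % 8 = i ^^^ j := by
    rw [show (8 : ℕ) = 2 ^ 3 from rfl, Nat.xor_mod_two_pow]
    congr 1 <;> omega
  omega

lemma xor_le_add_s19 (a b : ℕ) : a ^^^ b ≤ a + b := by
  induction a using Nat.strong_induction_on generalizing b with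
  | _ a ih =>
    rcases Nat.eq_zero_or_pos a with rfl | ha
    · simp
    have h := ih (a / 2) (by omega) (b / 2)
    have h1 : (a ^^^ b) / 2 = a / 2 ^^^ b / 2 := by
      simpa using Nat.xor_div_two_pow (a := a) (b := b) (n := 1)
    have h2 : (a ^^^ b) % 2 = (a + b) % 2 := by
      rcases Nat.mod_two_eq_zero_or_one a with ha | ha <;>
        rcases Nat.mod_two_eq_zero_or_one b with hb | hb <;>
        simp [Nat.xor_mod_two_eq, Nat.add_mod, ha, hb]
    omega

/-- The number of full blocks of length `m` needed to reach the nim-value `v` by pile sizes whose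
shifted sum has the parity of `p`. -/
def blockCost (v p : ℕ) : ℕ :=
  6 * (v / 8) + (v / 2 % 2 + if (v + p) % 2 = 1 then 2 else if v / 4 % 2 = 1 then 4 else 0)

lemma blockCost_mod_two (v p : ℕ) : blockCost v (p % 2) = blockCost v p := by
  simp [blockCost]

lemma blockCost_eight_mul_add (t p : ℕ) {i : ℕ} (hi : i < 8) :
    blockCost (8 * t + i) p = 6 * t + blockCost i p := by
  unfold blockCost
  rw [show (8 * t + i) / 8 = t by omega, show (8 * t + i) / 2 % 2 = i / 2 % 2 by omega,
    show (8 * t + i + p) % 2 = (i + p) % 2 by omega, show (8 * t + i) / 4 % 2 = i / 4 % 2 by omega,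
    show i / 8 = 0 by omega]
  omega

lemma blockCost_xor_le (v w p q : ℕ) :
    blockCost (v ^^^ w) (p + q) ≤ blockCost v p + blockCost w q := by
  have key : ∀ i < 8, ∀ j < 8, ∀ p < 2, ∀ q < 2,
      blockCost (i ^^^ j) ((p + q) % 2) ≤ blockCost i p + blockCost j q := by decide
  have hi : v % 8 < 8 := Nat.mod_lt _ (by norm_num)
  have hj : w % 8 < 8 := Nat.mod_lt _ (by norm_num)
  have hk := key _ hi _ hj (p % 2) (by omega) (q % 2) (by omega)
  rw [← Nat.add_mod, blockCost_mod_two, blockCost_mod_two, blockCost_mod_two] at hk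
  have ht := xor_le_add_s19 (v / 8) (w / 8)
  rw [← Nat.div_add_mod v 8, ← Nat.div_add_mod w 8, eight_mul_add_xor_s19 _ _ hi hj,
    blockCost_eight_mul_add _ _ (Nat.xor_lt_two_pow (n := 3) hi hj),
    blockCost_eight_mul_add _ _ hi, blockCost_eight_mul_add _ _ hj]
  omega

lemma blockCost_cutBase {m x : ℕ} (hm : m % 2 = 0) (hx : x < 6 * m) :
    m * blockCost (cutBase m x) x ≤ x ∧ x < m * blockCost (cutBase m x) x + m := by
  have hk : ∃ k, blockCost (cutBase m x) x = k ∧ k * m ≤ x ∧ x < k * m + m := by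
    refine ⟨_, rfl, ?_⟩
    rw [← blockCost_mod_two]
    unfold cutBase
    rcases Nat.mod_two_eq_zero_or_one x with h | h <;> rw [h] <;> split_ifs <;>
      simp [blockCost] <;> omega
  obtain ⟨k, hk, h1, h2⟩ := hk
  rw [hk, mul_comm]
  exact ⟨h1, h2⟩

lemma blockCost_cutSeq {m : ℕ} (hm : m % 2 = 0) (hm0 : 0 < m) (x : ℕ) :
    m * blockCost (cutSeq m x) x ≤ x ∧ x < m * blockCost (cutSeq m x) x + m := by
  have hx := Nat.mod_lt x (show 0 < 6 * m by omega)
  have hd := Nat.div_add_mod x (6 * m)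
  have h := blockCost_cutBase hm hx
  have hp : x % (6 * m) % 2 = x % 2 := Nat.mod_mod_of_dvd _ ⟨3 * m, by ring⟩
  rw [← blockCost_mod_two, hp, blockCost_mod_two] at h
  rw [cutSeq, blockCost_eight_mul_add _ _ (cutBase_lt _ _), mul_add,
    show m * (6 * (x / (6 * m))) = 6 * m * (x / (6 * m)) by ring]
  omega

/-- The value of `cutBase m x` in terms of the row `x / m`, the parity `p` of `x`, and the flag
`e` that `x = 2 * m`. -/
def cutRow (j : ℕ) (e : Bool) (p : ℕ) : ℕ :=
  if j = 0 then p else if j = 1 then 2 + p else if j = 2 then (if e then 1 - p else 5 - p)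
  else if j = 3 then 3 - p else if j = 4 then 4 + p else 6 + p

lemma cutBase_eq_cutRow {m x : ℕ} (hm0 : 0 < m) (hx : x < 6 * m) :
    cutBase m x = cutRow (x / m) (decide (x = 2 * m)) (x % 2) := by
  have h1 := Nat.div_mul_le_self x m
  have h2 := Nat.lt_div_mul_add hm0 (a := x)
  have h3 : x / m < 6 := Nat.div_lt_of_lt_mul (by rwa [mul_comm])
  generalize x / m = j at *
  interval_cases j <;> simp only [cutRow, cutBase, decide_eq_true_eq] <;> norm_num <;>
    split_ifs <;> omega

lemma cutRow_xor_ne : ∀ j < 6, ∀ k < 6 - j, ∀ p < 2, ∀ q < 2, ∀ d e : Bool,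
    cutRow j d p ^^^ cutRow k e q ≠ cutRow (j + k) false ((p + q + 1) % 2) := by
  decide +kernel

lemma cutRow_xor_ne_succ : ∀ j < 5, ∀ k < 5 - j, ∀ p < 2, ∀ q < 2, ∀ d e f : Bool,
    cutRow j d p ^^^ cutRow k e q ≠ cutRow (j + k + 1) f ((p + q + 1) % 2) := by
  decide +kernel

lemma cutBase_xor_ne {m x y : ℕ} (h : x + y + 1 < 6 * m) :
    cutBase m x ^^^ cutBase m y ≠ cutBase m (x + y + 1) := by
  have hm0 : 0 < m := by omega
  have hN : (x + y + 1) / m < 6 := Nat.div_lt_of_lt_mul (by rwa [mul_comm])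
  have hx1 := Nat.div_mul_le_self x m
  have hx2 := Nat.lt_div_mul_add hm0 (a := x)
  have hx0 := Nat.zero_le (x / m)
  have hy0 := Nat.zero_le (y / m)
  have hy1 := Nat.div_mul_le_self y m
  have hy2 := Nat.lt_div_mul_add hm0 (a := y)
  have hlo : x / m + y / m ≤ (x + y + 1) / m := by
    rw [Nat.le_div_iff_mul_le hm0, add_mul]
    omega
  have hhi : (x + y + 1) / m < x / m + y / m + 2 := by
    rw [Nat.div_lt_iff_lt_mul hm0, add_mul, add_mul]
    omega
  have hp : (x + y + 1) % 2 = (x % 2 + y % 2 + 1) % 2 := by omega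
  rw [cutBase_eq_cutRow hm0 (by omega), cutBase_eq_cutRow hm0 (by omega),
    cutBase_eq_cutRow hm0 h, hp]
  rcases Nat.lt_or_ge (x / m + y / m) ((x + y + 1) / m) with hlt | hge
  · rw [show (x + y + 1) / m = x / m + y / m + 1 by omega]
    exact cutRow_xor_ne_succ _ (by omega) _ (by omega)
      _ (Nat.mod_lt x two_pos) _ (Nat.mod_lt y two_pos) _ _ _
  · have hq : (x + y + 1) / m = x / m + y / m := by omega
    have hne : x + y + 1 ≠ 2 * m := by
      intro he
      rw [he, Nat.mul_div_cancel _ hm0] at hq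
      have : (x / m + y / m) * m = 2 * m := by rw [← hq]
      rw [add_mul] at this
      omega
    rw [hq, decide_eq_false hne]
    exact cutRow_xor_ne _ (by omega) _ (by omega)
      _ (Nat.mod_lt x two_pos) _ (Nat.mod_lt y two_pos) _ _

lemma cutSeq_xor_ne {m : ℕ} (hm0 : 0 < m) (x y : ℕ) :
    cutSeq m x ^^^ cutSeq m y ≠ cutSeq m (x + y + 1) := by
  intro he
  have hpos : 0 < 6 * m := by omega
  have hN := Nat.mod_lt (x + y + 1) hpos
  have dx := Nat.div_add_mod x (6 * m)
  have dy := Nat.div_add_mod y (6 * m)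
  have dN := Nat.div_add_mod (x + y + 1) (6 * m)
  have bN := cutBase_lt m ((x + y + 1) % (6 * m))
  have bxy : cutBase m (x % (6 * m)) ^^^ cutBase m (y % (6 * m)) < 8 :=
    Nat.xor_lt_two_pow (n := 3) (cutBase_lt _ _) (cutBase_lt _ _)
  have ht := xor_le_add_s19 (x / (6 * m)) (y / (6 * m))
  rw [cutSeq, cutSeq, cutSeq, eight_mul_add_xor_s19 _ _ (cutBase_lt _ _) (cutBase_lt _ _)] at he
  have hle : x / (6 * m) + y / (6 * m) ≤ (x + y + 1) / (6 * m) := by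
    rw [Nat.le_div_iff_mul_le hpos, mul_comm, mul_add]
    omega
  have hq : (x + y + 1) / (6 * m) = x / (6 * m) + y / (6 * m) := by omega
  have hr : (x + y + 1) % (6 * m) = x % (6 * m) + y % (6 * m) + 1 := by
    rw [hq, mul_add] at dN
    omega
  refine cutBase_xor_ne (m := m) (x := x % (6 * m)) (y := y % (6 * m)) (by omega) ?_
  rw [← hr]
  omega

/-- The least sum of shifted pile sizes of parity `p` found to have nim-value `v < 8`. -/
def reachCost (m v p : ℕ) : ℕ :=
  if (v + p) % 2 = 0 then
    (if v < 2 then 0 else if v < 4 then m else if v < 6 then 4 * m else 5 * m) + v % 2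
  else if v = 0 then 2 * m + 1 else if v = 1 then 2 * m else if v = 2 then 3 * m + 1
  else if v = 3 then 3 * m else if v = 4 then 2 * m + 1 else if v = 5 then 2 * m + 2
  else if v = 6 then 3 * m + 1 else 3 * m + 2

set_option maxHeartbeats 1000000 in
lemma exists_xor_eq_of_reachCost {m v : ℕ} (p : ℕ) (hm : m % 2 = 0) (hm4 : 4 ≤ m) (hv : v < 8) :
    ∃ x y, x < 6 * m ∧ y < 6 * m ∧ cutBase m x ^^^ cutBase m y = v ∧
      (x + y) % 2 = p % 2 ∧ x + y = reachCost m v p := by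
  have mk (x y a b : ℕ) (hx : x < 6 * m) (hy : y < 6 * m) (ha : cutBase m x = a)
      (hb : cutBase m y = b) (hab : a ^^^ b = v) (hp : (x + y) % 2 = p % 2)
      (hc : x + y = reachCost m v p) : ∃ x y, x < 6 * m ∧ y < 6 * m ∧
      cutBase m x ^^^ cutBase m y = v ∧ (x + y) % 2 = p % 2 ∧ x + y = reachCost m v p :=
    ⟨x, y, hx, hy, by rw [ha, hb, hab], hp, hc⟩
  by_cases hpar : (v + p) % 2 = 0 <;> interval_cases v
  · exact mk 0 0 0 0 (by omega) (by omega) (by unfold cutBase; split_ifs <;> omega)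
      (by unfold cutBase; split_ifs <;> omega) rfl (by omega) (by simp [reachCost]; try omega)
  · exact mk 1 0 1 0 (by omega) (by omega) (by unfold cutBase; split_ifs <;> omega)
      (by unfold cutBase; split_ifs <;> omega) rfl (by omega) (by simp [reachCost, hpar]; try omega)
  · exact mk m 0 2 0 (by omega) (by omega) (by unfold cutBase; split_ifs <;> omega)
      (by unfold cutBase; split_ifs <;> omega) rfl (by omega) (by simp [reachCost, hpar]; try omega)
  · exact mk (m + 1) 0 3 0 (by omega) (by omega) (by unfold cutBase; split_ifs <;> omega)
      (by unfold cutBase; split_ifs <;> omega) rfl (by omega) (by simp [reachCost, hpar]; try omega)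
  · exact mk (4 * m) 0 4 0 (by omega) (by omega) (by unfold cutBase; split_ifs <;> omega)
      (by unfold cutBase; split_ifs <;> omega) rfl (by omega) (by simp [reachCost, hpar]; try omega)
  · exact mk (4 * m + 1) 0 5 0 (by omega) (by omega) (by unfold cutBase; split_ifs <;> omega)
      (by unfold cutBase; split_ifs <;> omega) rfl (by omega) (by simp [reachCost, hpar]; try omega)
  · exact mk (5 * m) 0 6 0 (by omega) (by omega) (by unfold cutBase; split_ifs <;> omega)
      (by unfold cutBase; split_ifs <;> omega) rfl (by omega) (by simp [reachCost, hpar]; try omega)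
  · exact mk (5 * m + 1) 0 7 0 (by omega) (by omega) (by unfold cutBase; split_ifs <;> omega)
      (by unfold cutBase; split_ifs <;> omega) rfl (by omega) (by simp [reachCost, hpar]; try omega)
  · exact mk (2 * m) 1 1 1 (by omega) (by omega) (by unfold cutBase; split_ifs <;> omega)
      (by unfold cutBase; split_ifs <;> omega) rfl (by omega) (by simp [reachCost]; try omega)
  · exact mk (2 * m) 0 1 0 (by omega) (by omega) (by unfold cutBase; split_ifs <;> omega)
      (by unfold cutBase; split_ifs <;> omega) rfl (by omega) (by simp [reachCost, hpar]; try omega)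
  · exact mk (3 * m + 1) 0 2 0 (by omega) (by omega) (by unfold cutBase; split_ifs <;> omega)
      (by unfold cutBase; split_ifs <;> omega) rfl (by omega) (by simp [reachCost]; try omega)
  · exact mk (3 * m) 0 3 0 (by omega) (by omega) (by unfold cutBase; split_ifs <;> omega)
      (by unfold cutBase; split_ifs <;> omega) rfl (by omega) (by simp [reachCost, hpar]; try omega)
  · exact mk (2 * m + 1) 0 4 0 (by omega) (by omega) (by unfold cutBase; split_ifs <;> omega)
      (by unfold cutBase; split_ifs <;> omega) rfl (by omega) (by simp [reachCost, hpar]; try omega)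
  · exact mk (2 * m + 2) 0 5 0 (by omega) (by omega) (by unfold cutBase; split_ifs <;> omega)
      (by unfold cutBase; split_ifs <;> omega) rfl (by omega) (by simp [reachCost, hpar]; try omega)
  · exact mk (2 * m + 1) m 4 2 (by omega) (by omega) (by unfold cutBase; split_ifs <;> omega)
      (by unfold cutBase; split_ifs <;> omega) rfl (by omega) (by simp [reachCost, hpar]; try omega)
  · exact mk (2 * m + 2) m 5 2 (by omega) (by omega) (by unfold cutBase; split_ifs <;> omega)
      (by unfold cutBase; split_ifs <;> omega) rfl (by omega) (by simp [reachCost, hpar]; try omega)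

lemma exists_xor_eq_of_lt_cutBase {m v N : ℕ} (hm : m % 2 = 0) (hm4 : 4 ≤ m) (hN : N < 6 * m)
    (hv : v < cutBase m N) :
    ∃ x y, x < 6 * m ∧ y < 6 * m ∧ cutBase m x ^^^ cutBase m y = v ∧
      (x + y + 1 = N ∨ x + y + m ≤ N ∧ (x + y) % 2 = N % 2) := by
  have hv8 := hv.trans (cutBase_lt m N)
  by_cases hc : reachCost m v N + m ≤ N
  · obtain ⟨x, y, hx, hy, he, hp, hs⟩ := exists_xor_eq_of_reachCost N hm hm4 hv8
    exact ⟨x, y, hx, hy, he, Or.inr ⟨by omega, hp⟩⟩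
  have mk (x y a b : ℕ) (hs : x + y + 1 = N) (ha : cutBase m x = a)
      (hb : cutBase m y = b) (hab : a ^^^ b = v) : ∃ x y, x < 6 * m ∧ y < 6 * m ∧
      cutBase m x ^^^ cutBase m y = v ∧ (x + y + 1 = N ∨ x + y + m ≤ N ∧ (x + y) % 2 = N % 2) :=
    ⟨x, y, by omega, by omega, by rw [ha, hb, hab], Or.inl hs⟩
  have b0 {x : ℕ} (h : x < m) : cutBase m x = x % 2 := if_pos h
  have b1 {x : ℕ} (h : m ≤ x) (h' : x < 2 * m) : cutBase m x = 2 + x % 2 := by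
    unfold cutBase; split_ifs <;> omega
  have b2 {x : ℕ} (h : 2 * m < x) (h' : x < 3 * m) : cutBase m x = 5 - x % 2 := by
    unfold cutBase; split_ifs <;> omega
  have last (h : cutBase m (N - 1) = v) (h1 : 1 ≤ N) : ∃ x y, x < 6 * m ∧ y < 6 * m ∧
      cutBase m x ^^^ cutBase m y = v ∧
      (x + y + 1 = N ∨ x + y + m ≤ N ∧ (x + y) % 2 = N % 2) :=
    mk (N - 1) 0 v 0 (by omega) h (b0 (by omega)) (by simp)
  rcases lt_or_ge N m with h1 | h1
  · rw [b0 h1] at hv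
    exact last (by rw [b0 (by omega)]; omega) (by omega)
  rcases lt_or_ge N (2 * m) with h2 | h2
  · rw [b1 h1 h2] at hv
    by_cases hv2 : v = 2
    · exact last (by rw [b1 (by omega) (by omega)]; omega) (by omega)
    · have hpar : (v + N) % 2 = 1 := by
        by_contra hpar
        apply hc
        rw [reachCost, if_pos (by omega), if_pos (by omega)]
        omega
      refine mk (m - 1) (N - m) 1 (N % 2) (by omega) (by rw [b0 (by omega)]; omega)
        (by rw [b0 (by omega)]; omega) ?_
      rcases Nat.mod_two_eq_zero_or_one N with h | h <;> rw [h] <;> simp <;> omega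
  rcases eq_or_ne N (2 * m) with h | h
  · exfalso
    apply hc
    have : cutBase m N = 1 := by unfold cutBase; split_ifs <;> omega
    rw [reachCost, if_pos (by omega), if_pos (by omega)]
    omega
  rcases lt_or_ge N (3 * m) with h3 | h3
  · rw [b2 (by omega) h3] at hv
    by_cases hv4 : v = 4
    · exact last (by rw [b2 (by omega) (by omega)]; omega) (by omega)
    have hpar : (v + N) % 2 = 1 := by
      by_contra hpar
      apply hc
      rw [reachCost, if_pos (by omega)]
      split_ifs <;> omega
    by_cases hv2 : v < 2
    · refine mk m (N - 1 - m) 2 (3 - N % 2) (by omega) (by rw [b1 (by omega) (by omega)]; omega)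
        (by rw [b1 (by omega) (by omega)]; omega) ?_
      rcases Nat.mod_two_eq_zero_or_one N with h | h <;> rw [h] <;> simp <;> omega
    · refine mk (2 * m - 1) (N - 2 * m) 3 (N % 2) (by omega)
        (by rw [b1 (by omega) (by omega)]; omega) (by rw [b0 (by omega)]; omega) ?_
      rcases Nat.mod_two_eq_zero_or_one N with h | h <;> rw [h] <;> simp <;> omega
  exfalso
  apply hc
  have hv' : v < if N < 4 * m then 3 - N % 2 else if N < 5 * m then 4 + N % 2 else 6 + N % 2 := by
    rwa [cutBase, if_neg (by omega), if_neg (by omega), if_neg h, if_neg (by omega)] at hv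
  clear hv mk last b0 b1 b2
  unfold reachCost
  interval_cases v <;> norm_num <;> split_ifs at hv' ⊢ <;> omega

lemma exists_xor_eq_of_lt_cutSeq {m v N : ℕ} (hm : m % 2 = 0) (hm4 : 4 ≤ m)
    (hv : v < cutSeq m N) :
    ∃ x y, cutSeq m x ^^^ cutSeq m y = v ∧
      (x + y + 1 = N ∨ x + y + m ≤ N ∧ (x + y) % 2 = N % 2) := by
  have hN := Nat.mod_lt N (show 0 < 6 * m by omega)
  have hd := Nat.div_add_mod N (6 * m)
  have hp : N % (6 * m) % 2 = N % 2 := Nat.mod_mod_of_dvd _ ⟨3 * m, by ring⟩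
  have hb := cutBase_lt m (N % (6 * m))
  have heven (t : ℕ) : 6 * m * t % 2 = 0 := by
    rw [show 6 * m * t = 2 * (3 * m * t) by ring, Nat.mul_mod_right]
  have hxor (t : ℕ) {x y : ℕ} (hx : x < 6 * m) (hy : y < 6 * m) :
      cutSeq m (6 * m * t + x) ^^^ cutSeq m y = 8 * t + (cutBase m x ^^^ cutBase m y) := by
    have := eight_mul_add_xor_s19 t 0 (cutBase_lt m x) (cutBase_lt m y)
    simpa [cutSeq_add t hx, cutSeq_of_lt hy] using this
  unfold cutSeq at hv
  have hev := heven (v / 8)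
  rcases lt_or_ge (v / 8) (N / (6 * m)) with ht | ht
  · obtain ⟨x, y, hx, hy, he, hpar, hs⟩ :=
      exists_xor_eq_of_reachCost N hm hm4 (Nat.mod_lt v (show 0 < 8 by norm_num))
    refine ⟨6 * m * (v / 8) + x, y, by rw [hxor _ hx hy]; omega, Or.inr ⟨?_, by omega⟩⟩
    have hle : 6 * m * (v / 8 + 1) ≤ 6 * m * (N / (6 * m)) := Nat.mul_le_mul_left _ ht
    rw [mul_add] at hle
    have hcost : reachCost m (v % 8) N ≤ 5 * m + N % 2 := by
      unfold reachCost
      split_ifs <;> omega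
    omega
  · have hq : v / 8 = N / (6 * m) := by omega
    obtain ⟨x, y, hx, hy, he, hs⟩ :=
      exists_xor_eq_of_lt_cutBase (v := v % 8) hm hm4 hN (by omega)
    rw [hq] at hev
    exact ⟨6 * m * (N / (6 * m)) + x, y, by rw [hxor _ hx hy]; omega, by omega⟩

lemma mul_blockCost_foldr_le {m : ℕ} (hm : m % 2 = 0) (hm0 : 0 < m) (l : List ℕ)
    (hl : ∀ x ∈ l, 0 < x) :
    m * blockCost ((l.map fun x => cutSeq m (x - 1)).foldr (· ^^^ ·) 0) (l.sum + l.length) +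
      l.length ≤ l.sum := by
  induction l with
  | nil => simp [blockCost]
  | cons a l ih =>
    have ih := ih fun x hx => hl x (List.mem_cons_of_mem _ hx)
    have ha := hl a List.mem_cons_self
    have h1 := (blockCost_cutSeq hm hm0 (a - 1)).1
    have h2 := blockCost_xor_le (cutSeq m (a - 1))
      ((l.map fun x => cutSeq m (x - 1)).foldr (· ^^^ ·) 0) (a - 1) (l.sum + l.length)
    have h3 := Nat.mul_le_mul_left m h2
    rw [mul_add, ← blockCost_mod_two,
      show (a - 1 + (l.sum + l.length)) % 2 = (a + l.sum + (l.length + 1)) % 2 by omega,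
      blockCost_mod_two] at h3
    simp only [List.map_cons, List.foldr_cons, List.sum_cons, List.length_cons]
    omega

lemma mex_eq_of_forall_lt {A : Set ℕ} {k : ℕ} (hk : k ∉ A) (h : ∀ v < k, v ∈ A) : mex A = k := by
  refine le_antisymm (Nat.sInf_le hk) ?_
  by_contra! hlt
  exact Nat.sInf_mem (s := {v | v ∉ A}) ⟨k, hk⟩ (h _ hlt)

/-- If `1` and the even number `m ≥ 4` are cuts and all other cuts are even and at least `m`, the
nim-sequence is `cutSeq m`. -/
lemma cutGAux_eq_cutSeq {C : Finset ℕ} {m : ℕ} (hm : m % 2 = 0) (hm4 : 4 ≤ m) (h1 : 1 ∈ C)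
    (hmC : m ∈ C) (hC : ∀ d ∈ C, d = 1 ∨ m ≤ d ∧ d % 2 = 0) (fuel n : ℕ) (hn : 1 ≤ n)
    (hfuel : n ≤ fuel) : cutGAux C fuel n = cutSeq m (n - 1) := by
  induction fuel generalizing n with
  | zero => omega
  | succ fuel ih =>
    have hmap : ∀ d ∈ C, ∀ l : List ℕ, l.length = d + 1 → (∀ x ∈ l, 0 < x) → l.sum = n →
        l.map (cutGAux C fuel) = l.map fun x => cutSeq m (x - 1) := by
      intro d hd l hlen hpos hsum
      refine List.map_congr_left fun x hx => ih x (hpos x hx) ?_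
      have hlen' := List.length_erase_of_mem hx
      have hsum' := List.sum_erase hx
      have hle : (l.erase x).length ≤ (l.erase x).sum :=
        List.length_le_sum_of_one_le _ fun y hy => hpos y (List.mem_of_mem_erase hy)
      have := hC d hd
      omega
    rw [cutGAux]
    apply mex_eq_of_forall_lt
    · rintro ⟨d, hd, l, hlen, hpos, hsum, hval⟩
      rw [hmap d hd l hlen hpos hsum] at hval
      rcases hC d hd with rfl | ⟨hmd, hd2⟩
      · obtain ⟨a, b, rfl⟩ := List.length_eq_two.1 hlen
        have ha := hpos a (by simp)
        have hb := hpos b (by simp)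
        simp only [List.sum_cons, List.sum_nil] at hsum
        refine cutSeq_xor_ne (m := m) (by omega) (a - 1) (b - 1) ?_
        rw [show a - 1 + (b - 1) + 1 = n - 1 by omega, ← hval]
        simp
      · have hle := mul_blockCost_foldr_le hm (by omega) l hpos
        have hN := (blockCost_cutSeq hm (by omega) (n - 1)).2
        rw [hval, hsum, hlen, ← blockCost_mod_two,
          show (n + (d + 1)) % 2 = (n - 1) % 2 by omega, blockCost_mod_two] at hle
        omega
    · intro v hv
      obtain ⟨x, y, he, hs | ⟨hs, hp⟩⟩ := exists_xor_eq_of_lt_cutSeq hm hm4 hv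
      · refine ⟨1, h1, [x + 1, y + 1], rfl, by simp, by simp; omega, ?_⟩
        rw [hmap 1 h1 _ rfl (by simp) (by simp; omega)]
        simpa using he
      · have hlen : ([x + 1, y + 1, (n - 1 - m - x - y) / 2 + 1, (n - 1 - m - x - y) / 2 + 1] ++
            List.replicate (m - 3) 1).length = m + 1 := by simp; omega
        have hpos : ∀ z ∈ [x + 1, y + 1, (n - 1 - m - x - y) / 2 + 1,
            (n - 1 - m - x - y) / 2 + 1] ++ List.replicate (m - 3) 1, 0 < z := by
          intro z hz
          simp at hz
          omega
        have hsum : ([x + 1, y + 1, (n - 1 - m - x - y) / 2 + 1, (n - 1 - m - x - y) / 2 + 1] ++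
            List.replicate (m - 3) 1).sum = n := by simp; omega
        refine ⟨m, hmC, _, hlen, hpos, hsum, ?_⟩
        rw [hmap m hmC _ hlen hpos hsum]
        have hzero (k : ℕ) : (List.replicate k (cutSeq m 0)).foldr (· ^^^ ·) 0 = 0 := by
          have h0 : cutSeq m 0 = 0 := by
            rw [cutSeq_of_lt (by omega), cutBase, if_pos (by omega)]
          rw [h0]
          induction k with
          | zero => rfl
          | succ k ih => simp [List.replicate_succ, ih]
        simp [hzero, he]

/-- CUT with cut-set `{1} ∪ {2s : s ∈ S}`, where every element of `S` is at least
`2`, has the same nim-sequence as CUT with cut-set `{1, 2c}`, `c = min S`. -/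
theorem cutG_extension (S : Finset ℕ) (hS : S.Nonempty) (h2 : ∀ s ∈ S, 2 ≤ s)
    (c : ℕ) (hc : c = S.min' hS) (n : ℕ) (hn : 1 ≤ n) :
    cutG (insert 1 (S.image (fun s => 2*s))) n = cutG {1, 2*c} n := by
  have hcS : c ∈ S := hc ▸ S.min'_mem hS
  have hmin : ∀ s ∈ S, c ≤ s := fun s hs => hc ▸ S.min'_le s hs
  have hc2 := h2 c hcS
  unfold cutG
  rw [cutGAux_eq_cutSeq (m := 2 * c) (by omega) (by omega) (by simp) _ _ n n hn le_rfl,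
    cutGAux_eq_cutSeq (m := 2 * c) (by omega) (by omega) (by simp) (by simp) _ n n hn le_rfl]
  · intro d hd
    simp only [Finset.mem_insert, Finset.mem_singleton] at hd
    omega
  · exact Finset.mem_insert_of_mem (Finset.mem_image_of_mem _ hcS)
  · intro d hd
    simp only [Finset.mem_insert, Finset.mem_image] at hd
    rcases hd with rfl | ⟨s, hs, rfl⟩
    · exact Or.inl rfl
    · have := hmin s hs
      omega
end
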